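/- For every ε > 0 there exists a finite constant C such that for every integer h ≥ 1 and every integer k lying in the interval [(h − h^{1/2+ε})/2, (h + h^{1/2+ε})/2], if the chain Z starts at k then E[τ̃_h] < C·h^{1/2+ε}. -/

import Mathlib

open MeasureTheory ProbabilityTheory
open scoped ENNReal

/-- ρ(i,j) := 2^{−i−j−1}·(i+j)!/(i!·j!). -/
noncomputable def rho (i j : ℕ) : ℝ :=
  (2 : ℝ) ^ (-(i : ℝ) - (j : ℝ) - 1) * (Nat.factorial (i + j)) /
    ((Nat.factorial i) * (Nat.factorial j))

/-- `Z` is a Markov chain with transition probabilities `trans` started at `k`: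
`P(Z_0 = k) = 1` and
`P(Z_0 = k_0, …, Z_n = k_n) = P(Z_0 = k_0) · ∏_{0 ≤ i < n} trans(k_i, k_{i+1})`. -/
def IsMarkovChainFrom {Ω : Type*} [MeasurableSpace Ω] (P : Measure Ω)
    (Z : ℕ → Ω → ℕ) (trans : ℕ → ℕ → ℝ) (k : ℕ) : Prop :=
  (∀ t, Measurable (Z t)) ∧
    ∀ (n : ℕ) (ks : ℕ → ℕ),
      P {ω | ∀ i ≤ n, Z i ω = ks i} =
        ENNReal.ofReal ((if ks 0 = k then 1 else 0) *
          ∏ i ∈ Finset.range n, trans (ks i) (ks (i + 1)))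


/-- `Z̃_t := Z_t + Z_{t−1} + 1`. -/
def Ztil {Ω : Type*} (Z : ℕ → Ω → ℕ) (t : ℕ) (ω : Ω) : ℕ :=
  Z t ω + Z (t - 1) ω + 1

/-- `τ̃_h := inf{t ≥ 1 : Z̃_t ≥ h}` (with value `∞` if there is no such `t`). -/
noncomputable def tauTil {Ω : Type*} (Z : ℕ → Ω → ℕ) (h : ℕ) (ω : Ω) : ℕ∞ :=
  sInf ((↑) '' {t : ℕ | 1 ≤ t ∧ h ≤ Ztil Z t ω} : Set ℕ∞)


lemma rho_eq (i j : ℕ) :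
    rho i j = (1 / 2) ^ (i + 1) * (((j + i).choose i : ℝ) * (1 / 2) ^ j) := by
  have h1 : (2 : ℝ) ^ (-(i : ℝ) - (j : ℝ) - 1) = (1 / 2) ^ (i + 1) * (1 / 2) ^ j := by
    rw [← pow_add, show -(i : ℝ) - (j : ℝ) - 1 = -((i + 1 + j : ℕ) : ℝ) by push_cast; ring,
      Real.rpow_neg (by norm_num), Real.rpow_natCast, one_div, inv_pow]
  have h2 : (((j + i).choose i : ℝ)) * (j.factorial * i.factorial) = (i + j).factorial := by
    have := Nat.add_choose_mul_factorial_mul_factorial j i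
    rw [add_comm i j, ← this, ← Nat.choose_symm_add]
    push_cast; ring
  have hi : (i.factorial : ℝ) ≠ 0 := by positivity
  have hj : (j.factorial : ℝ) ≠ 0 := by positivity
  rw [rho, h1, ← h2]
  field_simp

lemma rho_nonneg (i j : ℕ) : 0 ≤ rho i j := by
  rw [rho_eq]; positivity

/-- The generating function of `rho i`. -/
lemma hasSum_rho_mul_pow (i : ℕ) {x : ℝ} (hx : |x| < 2) :
    HasSum (fun j => rho i j * x ^ j) (1 / (2 - x) ^ (i + 1)) := by
  have hr : ‖x / 2‖ < 1 := by
    rw [Real.norm_eq_abs, abs_div, abs_two]; linarith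
  have h := (hasSum_choose_mul_geometric_of_norm_lt_one i hr).mul_left ((1 / 2 : ℝ) ^ (i + 1))
  have hx' : 2 - x ≠ 0 := by linarith [(abs_lt.mp hx).2]
  convert h using 1
  · rfl
  · funext j
    rw [rho_eq, div_pow x, one_div_pow 2 j]
    ring
  · rw [show 1 - x / 2 = (2 - x) * (1 / 2) by ring, mul_pow]
    field_simp

lemma hasSum_rho (i : ℕ) : HasSum (rho i) 1 := by
  simpa [show (2 : ℝ) - 1 = 1 by norm_num] using
    hasSum_rho_mul_pow i (x := 1) (by norm_num)

/-- The mean of `rho i`. -/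
lemma hasSum_rho_mul_cast (i : ℕ) : HasSum (fun j => rho i j * (j : ℝ)) (i + 1) := by
  rw [← hasSum_nat_add_iff' 1]
  have h := (hasSum_rho (i + 1)).mul_left ((i : ℝ) + 1)
  convert h using 1
  · rfl
  · funext j
    have hchoose := Nat.choose_succ_right_eq (j + 1 + i) i
    have choose_mul :
        ((j + 1 + i).choose (i + 1) : ℝ) * (i + 1) = (j + 1 + i).choose i * (j + 1) := by
      rw [show j + 1 + i - i = j + 1 by omega] at hchoose
      exact_mod_cast hchoose
    rw [rho_eq, rho_eq, show j + (i + 1) = j + 1 + i by ring]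
    push_cast
    rw [show (i + 1 : ℝ) * ((1 / 2) ^ (i + 1 + 1) * (((j + 1 + i).choose (i + 1)) * (1 / 2) ^ j))
      = (((j + 1 + i).choose (i + 1) : ℝ) * (i + 1)) * ((1 / 2) ^ (i + 1 + 1) * (1 / 2) ^ j) by ring,
      choose_mul]
    ring
  · simp

/-- Centred exponential moments of `rho i` are at most `4 / 3` at scale `h ^ (-1 / 2)`. -/
lemma one_div_pow_le {h i : ℕ} {u : ℝ} (hu : |u| ≤ 1 / 2) (huh : u ^ 2 * h ≤ 1 / 4)
    (hi : i + 1 ≤ h) :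
    1 / (1 - u) ^ (i + 1) ≤ 4 / 3 * (1 + u) ^ (i + 1) := by
  have h1 := (abs_le.mp hu).1
  have h2 := (abs_le.mp hu).2
  have hb : 1 + ((i + 1 : ℕ) : ℝ) * (-u ^ 2) ≤ (1 + -u ^ 2) ^ (i + 1) :=
    one_add_mul_le_pow (by nlinarith) _
  have hc : ((i + 1 : ℕ) : ℝ) ≤ h := by exact_mod_cast hi
  have hd : (3 : ℝ) / 4 ≤ (1 + -u ^ 2) ^ (i + 1) := by nlinarith [sq_nonneg u]
  rw [show 1 + -u ^ 2 = (1 - u) * (1 + u) by ring, mul_pow] at hd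
  rw [div_le_iff₀ (pow_pos (by linarith) _)]
  linarith

/-- The probability of not having left `{i + j + 1 < h}` during the first `n` steps from `i`. -/
noncomputable def survival (h : ℕ) : ℕ → ℕ → ℝ
  | 0, _ => 1
  | n + 1, i => ∑ j ∈ Finset.range (h - 1 - i), rho i j * survival h n j

lemma survival_nonneg (h n i : ℕ) : 0 ≤ survival h n i := by
  induction n generalizing i with
  | zero => simp [survival]
  | succ n ih => exact Finset.sum_nonneg fun j _ => mul_nonneg (rho_nonneg i j) (ih j)

/-- A Lyapunov function for the killed chain bounds its expected lifetime. -/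
lemma sum_survival_le {h : ℕ} {f : ℕ → ℝ} (hf0 : ∀ i, 0 ≤ f i)
    (hf : ∀ i, 1 + ∑ j ∈ Finset.range (h - 1 - i), rho i j * f j ≤ f i) (N i : ℕ) :
    ∑ n ∈ Finset.range N, survival h n i ≤ f i := by
  induction N generalizing i with
  | zero => simpa using hf0 i
  | succ N ih =>
    rw [Finset.sum_range_succ']
    simp only [survival]
    rw [Finset.sum_comm]
    refine le_trans ?_ (hf i)
    rw [add_comm]
    gcongr with j
    rw [← Finset.mul_sum]
    exact mul_le_mul_of_nonneg_left (ih j) (rho_nonneg i j)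

lemma sum_rho_mul_tsub_le {h i B S : ℕ} {u : ℝ} (hu0 : 0 < u) (hu : u ≤ 1 / 2)
    (huh : u ^ 2 * h ≤ 1 / 4) (hi : i + 1 ≤ h) (hiB : i + 1 + S ≤ B)
    (hS : 8 / 3 ≤ u * (1 + u) ^ S) :
    ∑ j ∈ Finset.range (h - 1 - i), rho i j * (((B - j : ℕ) : ℝ) + 1) ≤ B - i + 1 / 2 := by
  have hx : |1 + u| < 2 := by rw [abs_of_pos (by linarith)]; linarith
  have hsum := (((hasSum_rho i).mul_left ((B : ℝ) + 1)).sub (hasSum_rho_mul_cast i)).add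
    ((hasSum_rho_mul_pow i hx).mul_left (1 / (u * (1 + u) ^ B)))
  have hup : 0 < (1 + u) ^ B := by positivity
  have hpt : ∀ j, rho i j * (((B - j : ℕ) : ℝ) + 1) ≤
      ((B : ℝ) + 1) * rho i j - rho i j * j + 1 / (u * (1 + u) ^ B) * (rho i j * (1 + u) ^ j) := by
    intro j
    have : (((B - j : ℕ) : ℝ) + 1) ≤ B + 1 - j + 1 / (u * (1 + u) ^ B) * (1 + u) ^ j := by
      rcases le_total j B with hj | hj
      · rw [Nat.cast_sub hj]
        have : 0 ≤ 1 / (u * (1 + u) ^ B) * (1 + u) ^ j := by positivity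
        linarith
      · rw [Nat.sub_eq_zero_of_le hj]
        obtain ⟨d, rfl⟩ := Nat.exists_eq_add_of_le hj
        have h1 : 1 + (d : ℝ) * u ≤ (1 + u) ^ d := one_add_mul_le_pow (by linarith) d
        have h2 : 1 / (u * (1 + u) ^ B) * (1 + u) ^ (B + d) = (1 + u) ^ d / u := by
          rw [pow_add]; field_simp
        have h3 : (d : ℝ) ≤ (1 + u) ^ d / u := by
          rw [le_div_iff₀ hu0]; linarith
        rw [h2]; push_cast; linarith
    calc _ ≤ rho i j * (B + 1 - j + 1 / (u * (1 + u) ^ B) * (1 + u) ^ j) :=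
          mul_le_mul_of_nonneg_left this (rho_nonneg i j)
      _ = _ := by ring
  have hle : ∑ j ∈ Finset.range (h - 1 - i), rho i j * (((B - j : ℕ) : ℝ) + 1) ≤ _ :=
    (Finset.sum_le_sum fun j _ => hpt j).trans
      (sum_le_hasSum _ (fun j _ => le_trans (mul_nonneg (rho_nonneg i j) (by positivity)) (hpt j))
        hsum)
  refine hle.trans ?_
  have hm : 1 / (2 - (1 + u)) ^ (i + 1) ≤ 4 / 3 * (1 + u) ^ (i + 1) := by
    rw [show 2 - (1 + u) = 1 - u by ring]
    exact one_div_pow_le (by rwa [abs_of_pos hu0]) huh hi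
  have hB : (1 + u) ^ (i + 1) * (1 + u) ^ S ≤ (1 + u) ^ B := by
    rw [← pow_add]; exact pow_le_pow_right₀ (by linarith) hiB
  have hfin : 1 / (u * (1 + u) ^ B) * (1 / (2 - (1 + u)) ^ (i + 1)) ≤ 1 / 2 := by
    rw [one_div_mul_eq_div, div_le_iff₀ (by positivity)]
    have hp : 0 < (1 + u) ^ (i + 1) := by positivity
    nlinarith [mul_le_mul_of_nonneg_left hB hu0.le, mul_le_mul_of_nonneg_left hS hp.le]
  linarith

lemma sum_rho_le {h i S : ℕ} {u : ℝ} (hu0 : 0 < u) (hu : u ≤ 1 / 2)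
    (huh : u ^ 2 * h ≤ 1 / 4) (hi : i + 1 ≤ h) (hiS : h + S ≤ 2 * i + 3) :
    ∑ j ∈ Finset.range (h - 1 - i), rho i j ≤ 4 / 3 * (1 - u) ^ S := by
  have hx : |1 - u| < 2 := by rw [abs_of_pos (by linarith)]; linarith
  have hy : 0 < 1 - u := by linarith
  have hm : 1 / (2 - (1 - u)) ^ (i + 1) ≤ 4 / 3 * (1 - u) ^ (i + 1) := by
    have := one_div_pow_le (u := -u) (by rwa [abs_neg, abs_of_pos hu0]) (by rwa [neg_sq]) hi
    rwa [sub_neg_eq_add, ← sub_eq_add_neg, show 1 + u = 2 - (1 - u) by ring] at this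
  have hfin : ∑ j ∈ Finset.range (h - 1 - i), rho i j * (1 - u) ^ (i + 1) ≤
      4 / 3 * (1 - u) ^ (i + 1) * (1 - u) ^ S := by
    calc _ ≤ ∑ j ∈ Finset.range (h - 1 - i), rho i j * (1 - u) ^ j * (1 - u) ^ S := by
          refine Finset.sum_le_sum fun j hj => ?_
          rw [mul_assoc, ← pow_add]
          refine mul_le_mul_of_nonneg_left ?_ (rho_nonneg i j)
          refine pow_le_pow_of_le_one hy.le (by linarith) ?_
          have := Finset.mem_range.mp hj
          omega
      _ ≤ _ := by
          rw [← Finset.sum_mul]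
          gcongr
          exact (sum_le_hasSum _ (fun j _ => mul_nonneg (rho_nonneg i j) (by positivity))
            (hasSum_rho_mul_pow i hx)).trans hm
  rw [← Finset.sum_mul] at hfin
  have hp : 0 < (1 - u) ^ (i + 1) := by positivity
  exact le_of_mul_le_mul_right (by linarith) hp

lemma exp_half_le_one_add_pow {u : ℝ} (hu0 : 0 ≤ u) (hu : u ≤ 1 / 2) (S : ℕ) :
    Real.exp (u * S / 2) ≤ (1 + u) ^ S := by
  have h1 : Real.exp (u / 2) ≤ 1 + u := by
    have h2 : 1 - u / 2 ≤ Real.exp (-(u / 2)) := by linarith [Real.add_one_le_exp (-(u / 2))]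
    have h3 := Real.exp_pos (u / 2)
    have h4 : Real.exp (u / 2) * Real.exp (-(u / 2)) = 1 := by rw [← Real.exp_add]; simp
    have h5 : Real.exp (u / 2) * (1 - u / 2) ≤ 1 := by
      exact (mul_le_mul_of_nonneg_left h2 h3.le).trans_eq h4
    have h6 : 1 ≤ (1 + u) * (1 - u / 2) := by nlinarith
    exact le_of_mul_le_mul_right (h5.trans h6) (by linarith)
  calc Real.exp (u * S / 2) = Real.exp (u / 2) ^ S := by
        rw [← Real.exp_nat_mul]; congr 1; ring
    _ ≤ _ := pow_le_pow_left₀ (Real.exp_pos _).le h1 S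

lemma lyapunov_step {h S : ℕ} {u : ℝ} (hh : 1 ≤ h) (hu0 : 0 < u) (huh : u ^ 2 * h = 1 / 4)
    (hS : 8 * (h : ℝ) ≤ Real.exp (u * S / 2)) (i : ℕ) :
    1 / 2 + ∑ j ∈ Finset.range (h - 1 - i), rho i j * (((h / 2 + 2 * S - j : ℕ) : ℝ) + 1) ≤
      ((h / 2 + 2 * S - i : ℕ) : ℝ) + 1 := by
  have hh' : (1 : ℝ) ≤ h := by exact_mod_cast hh
  have hu : u ≤ 1 / 2 := by nlinarith
  rcases le_or_gt h (i + 1) with hi | hi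
  · rw [show h - 1 - i = 0 by omega]
    simp only [Finset.range_zero, Finset.sum_empty]
    have : (0 : ℝ) ≤ ((h / 2 + 2 * S - i : ℕ) : ℝ) := by positivity
    linarith
  rcases le_or_gt (i + 1 + S) (h / 2 + 2 * S) with hc | hc
  · have := sum_rho_mul_tsub_le hu0 hu huh.le hi.le hc (by
      have h1 := hS.trans (exp_half_le_one_add_pow hu0.le hu S)
      have h2 : 1 / 2 ≤ u * h := by nlinarith
      nlinarith [mul_le_mul_of_nonneg_left h1 hu0.le])
    rw [Nat.cast_sub (by omega : i ≤ h / 2 + 2 * S)]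
    linarith
  · have h1 := sum_rho_le (S := 2 * S) hu0 hu huh.le hi.le (by omega)
    have h2 : (1 - u) ^ (2 * S) ≤ 1 / (8 * (h : ℝ)) := by
      have h3 : (1 - u) ^ (2 * S) ≤ Real.exp (-(u * S / 2)) := by
        calc (1 - u) ^ (2 * S) ≤ Real.exp (-u) ^ (2 * S) :=
              pow_le_pow_left₀ (by linarith) (by linarith [Real.add_one_le_exp (-u)]) _
          _ = Real.exp (-(2 * (u * S))) := by
              rw [← Real.exp_nat_mul]; congr 1; push_cast; ring
          _ ≤ _ := Real.exp_le_exp.mpr (by have : 0 ≤ u * S := by positivity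
                                           linarith)
      refine h3.trans ?_
      rw [Real.exp_neg, ← one_div]
      exact one_div_le_one_div_of_le (by positivity) hS
    have h4 : ∑ j ∈ Finset.range (h - 1 - i), rho i j * (((h / 2 + 2 * S - j : ℕ) : ℝ) + 1) ≤
        (∑ j ∈ Finset.range (h - 1 - i), rho i j) * (3 * h) := by
      rw [Finset.sum_mul]
      refine Finset.sum_le_sum fun j _ => mul_le_mul_of_nonneg_left ?_ (rho_nonneg i j)
      have : h / 2 + 2 * S - j + 1 ≤ 3 * h := by omega
      exact_mod_cast this
    have h5 : (∑ j ∈ Finset.range (h - 1 - i), rho i j) * (3 * h) ≤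
        4 / 3 * (1 / (8 * (h : ℝ))) * (3 * h) := by
      gcongr
      linarith
    have h6 : 4 / 3 * (1 / (8 * (h : ℝ))) * (3 * h) = 1 / 2 := by field_simp; norm_num
    have : (0 : ℝ) ≤ ((h / 2 + 2 * S - i : ℕ) : ℝ) := by positivity
    linarith

/-- The event that `Z̃` stays below `h` at the times `m + 1, …, m + n`. -/
def aliveSet {Ω : Type*} (Z : ℕ → Ω → ℕ) (h m n : ℕ) : Set Ω :=
  {ω | ∀ i < n, Z (m + i) ω + Z (m + i + 1) ω + 1 < h}

section MarkovChain

variable {Ω : Type*} [MeasurableSpace Ω] {P : Measure Ω} {Z : ℕ → Ω → ℕ} {k : ℕ}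

lemma measure_cylinder_inter_aliveSet_le (hZ : IsMarkovChainFrom P Z rho k) (h n m : ℕ)
    (ks : ℕ → ℕ) :
    P ({ω | ∀ i ≤ m, Z i ω = ks i} ∩ aliveSet Z h m n) ≤
      P {ω | ∀ i ≤ m, Z i ω = ks i} * ENNReal.ofReal (survival h n (ks m)) := by
  induction n generalizing m ks with
  | zero =>
    simpa [survival] using measure_mono Set.inter_subset_left
  | succ n ih =>
    let path : ℕ → ℕ → ℕ := fun j => Function.update ks (m + 1) j
    have hpath : ∀ j, ∀ i ≤ m, path j i = ks i := fun j i hi =>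
      Function.update_of_ne (by omega) _ _
    have hpath_last : ∀ j, path j (m + 1) = j := fun j => Function.update_self _ _ _
    have hsub : {ω | ∀ i ≤ m, Z i ω = ks i} ∩ aliveSet Z h m (n + 1) ⊆
        ⋃ j ∈ Finset.range (h - 1 - ks m),
          {ω | ∀ i ≤ m + 1, Z i ω = path j i} ∩ aliveSet Z h (m + 1) n := by
      rintro ω ⟨h1, h2⟩
      have h3 := h2 0 (by omega)
      have h4 := h1 m le_rfl
      simp only [add_zero] at h3
      simp only [Set.mem_iUnion]
      refine ⟨Z (m + 1) ω, Finset.mem_range.mpr (by omega), fun i hi => ?_, fun i hi => ?_⟩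
      · rcases Nat.le_succ_iff.mp hi with hi | rfl
        · rw [hpath _ i hi, h1 i hi]
        · rw [hpath_last]
      · have := h2 (i + 1) (by omega)
        rwa [show m + (i + 1) = m + 1 + i by omega] at this
    have hcyl : ∀ j, P {ω | ∀ i ≤ m + 1, Z i ω = path j i} =
        P {ω | ∀ i ≤ m, Z i ω = ks i} * ENNReal.ofReal (rho (ks m) j) := by
      intro j
      rw [hZ.2, hZ.2, ← ENNReal.ofReal_mul', Finset.prod_range_succ, hpath_last j, hpath j m le_rfl,
        hpath j 0 (Nat.zero_le _), ← mul_assoc]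
      · congr 3
        refine Finset.prod_congr rfl fun i hi => ?_
        have := Finset.mem_range.mp hi
        rw [hpath j i (by omega), hpath j (i + 1) (by omega)]
      · exact rho_nonneg _ _
    calc _ ≤ _ := measure_mono hsub
      _ ≤ _ := measure_biUnion_finset_le _ _
      _ ≤ ∑ j ∈ Finset.range (h - 1 - ks m), P {ω | ∀ i ≤ m, Z i ω = ks i} *
            ENNReal.ofReal (rho (ks m) j * survival h n j) := by
          refine Finset.sum_le_sum fun j _ => (ih (m + 1) (path j)).trans_eq ?_
          rw [hcyl, hpath_last, mul_assoc, ENNReal.ofReal_mul (rho_nonneg _ _)]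
      _ = _ := by
          rw [← Finset.mul_sum, ← ENNReal.ofReal_sum_of_nonneg fun j _ =>
            mul_nonneg (rho_nonneg _ _) (survival_nonneg _ _ _)]
          rfl

lemma measure_aliveSet_le [IsProbabilityMeasure P] (hZ : IsMarkovChainFrom P Z rho k) (h n : ℕ) :
    P (aliveSet Z h 0 n) ≤ ENNReal.ofReal (survival h n k) := by
  have h1 := measure_cylinder_inter_aliveSet_le hZ h n 0 (fun _ => k)
  have h0 : P {ω | ∀ i ≤ 0, Z i ω = k} = 1 := by
    simpa using hZ.2 0 (fun _ => k)
  rw [h0, one_mul] at h1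
  have hae : ∀ᵐ ω ∂P, ∀ i ≤ 0, Z i ω = k := by
    rw [← prob_compl_eq_zero_iff] at h0
    · exact h0
    · simpa [Set.preimage] using hZ.1 0 (measurableSet_singleton k)
  refine le_trans (measure_mono_ae ?_) h1
  filter_upwards [hae] with ω hω hA using ⟨hω, hA⟩

lemma measurableSet_aliveSet (hZ : ∀ t, Measurable (Z t)) (h m n : ℕ) :
    MeasurableSet (aliveSet Z h m n) := by
  simp only [aliveSet, Set.ofPred_forall]
  refine MeasurableSet.iInter fun i => MeasurableSet.iInter fun _ => ?_
  exact measurableSet_lt (((hZ _).add (hZ _)).add_const 1) measurable_const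

end MarkovChain

lemma tauTil_le_tsum {Ω : Type*} (Z : ℕ → Ω → ℕ) (h : ℕ) (ω : Ω) :
    ((tauTil Z h ω : ℕ∞) : ℝ≥0∞) ≤ ∑' n, (aliveSet Z h 0 n).indicator 1 ω := by
  by_cases hall : ∀ n, ω ∈ aliveSet Z h 0 n
  · have : ∑' n, (aliveSet Z h 0 n).indicator (1 : Ω → ℝ≥0∞) ω = ⊤ := by
      simp [Set.indicator_of_mem (hall _)]
    rw [this]; exact le_top
  · push Not at hall
    classical
    let N := Nat.find hall
    have hN : ω ∉ aliveSet Z h 0 N := Nat.find_spec hall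
    have hlt : ∀ n < N, ω ∈ aliveSet Z h 0 n := fun n hn => not_not.mp (Nat.find_min hall hn)
    have hτ : tauTil Z h ω ≤ (N : ℕ∞) := by
      simp only [aliveSet, Set.mem_ofPred_eq, not_forall, zero_add] at hN
      obtain ⟨i, hi, hi'⟩ := hN
      have hmem : i + 1 ∈ {t : ℕ | 1 ≤ t ∧ h ≤ Ztil Z t ω} := by
        refine ⟨by omega, ?_⟩
        simp only [Ztil, Nat.add_sub_cancel]
        omega
      exact (sInf_le (Set.mem_image_of_mem _ hmem)).trans (Nat.cast_le.mpr hi)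
    calc ((tauTil Z h ω : ℕ∞) : ℝ≥0∞) ≤ ((N : ℕ∞) : ℝ≥0∞) := ENat.toENNReal_mono hτ
      _ = ∑ n ∈ Finset.range N, (aliveSet Z h 0 n).indicator (1 : Ω → ℝ≥0∞) ω := by
          rw [Finset.sum_congr rfl fun n hn =>
            Set.indicator_of_mem (hlt n (Finset.mem_range.mp hn)) _]
          simp
      _ ≤ _ := ENNReal.sum_le_tsum _

lemma lintegral_tauTil_le {Ω : Type*} [MeasurableSpace Ω] {P : Measure Ω} [IsProbabilityMeasure P]
    {Z : ℕ → Ω → ℕ} {k h : ℕ} (hZ : IsMarkovChainFrom P Z rho k) {b : ℝ}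
    (hb : ∀ N, ∑ n ∈ Finset.range N, survival h n k ≤ b) :
    ∫⁻ ω, ((tauTil Z h ω : ℕ∞) : ℝ≥0∞) ∂P ≤ ENNReal.ofReal b := by
  calc _ ≤ ∫⁻ ω, ∑' n, (aliveSet Z h 0 n).indicator 1 ω ∂P :=
        lintegral_mono fun ω => tauTil_le_tsum Z h ω
    _ = ∑' n, P (aliveSet Z h 0 n) := by
        rw [lintegral_tsum fun n =>
          (measurable_one.indicator (measurableSet_aliveSet hZ.1 h 0 n)).aemeasurable]
        exact tsum_congr fun n => lintegral_indicator_one (measurableSet_aliveSet hZ.1 h 0 n)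
    _ ≤ ∑' n, ENNReal.ofReal (survival h n k) :=
        ENNReal.tsum_le_tsum fun n => measure_aliveSet_le hZ h n
    _ ≤ _ := ENNReal.tsum_le_of_sum_range_le fun N => by
        rw [← ENNReal.ofReal_sum_of_nonneg fun n _ => survival_nonneg _ _ _]
        exact ENNReal.ofReal_le_ofReal (hb N)

/-- A stretched exponential with a suitable constant dominates `8 h`, uniformly in `h ≥ 1`. -/
lemma exists_eight_mul_le_exp {ε : ℝ} (hε : 0 < ε) :
    ∃ A : ℝ, 0 < A ∧ ∀ h : ℕ, 1 ≤ h → 8 * (h : ℝ) ≤ Real.exp (A * (h : ℝ) ^ ε) := by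
  obtain ⟨n, hn⟩ := exists_nat_ge (1 / ε)
  have hn' : 1 ≤ ε * n := by rwa [div_le_iff₀' hε] at hn
  have hn0 : n ≠ 0 := by rintro rfl; norm_num at hn'
  refine ⟨8 * n.factorial, by positivity, fun h hh => ?_⟩
  have hh' : (1 : ℝ) ≤ h := by exact_mod_cast hh
  have hf : (1 : ℝ) ≤ n.factorial := by exact_mod_cast Nat.factorial_pos n
  have h1 := Real.pow_div_factorial_le_exp (8 * n.factorial * (h : ℝ) ^ ε) (by positivity) n
  refine le_trans ?_ h1
  rw [le_div_iff₀ (by positivity), mul_pow]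
  have h2 : (h : ℝ) ≤ ((h : ℝ) ^ ε) ^ n := by
    rw [← Real.rpow_mul_natCast (by positivity)]
    simpa using Real.rpow_le_rpow_of_exponent_le hh' hn'
  have h3 : (8 * n.factorial : ℝ) ≤ (8 * n.factorial) ^ n :=
    le_self_pow₀ (by linarith) hn0
  calc 8 * (h : ℝ) * n.factorial = (8 * n.factorial) * h := by ring
    _ ≤ _ := mul_le_mul h3 h2 (by positivity) (by positivity)

/-- For every ε > 0 there exists a finite constant C such that for every integer
h ≥ 1 and every integer k ∈ [(h − h^{1/2+ε})/2, (h + h^{1/2+ε})/2], if the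
chain Z starts at k then E[τ̃_h] < C·h^{1/2+ε}. -/
theorem stmt_11 :
    ∀ ε : ℝ, 0 < ε → ∃ C : ℝ,
      ∀ (h k : ℕ), 1 ≤ h →
        ((h : ℝ) - (h : ℝ) ^ ((1 : ℝ) / 2 + ε)) / 2 ≤ (k : ℝ) →
        (k : ℝ) ≤ ((h : ℝ) + (h : ℝ) ^ ((1 : ℝ) / 2 + ε)) / 2 →
        ∀ (Ω : Type) (_ : MeasurableSpace Ω) (P : Measure Ω) (Z : ℕ → Ω → ℕ),
          IsProbabilityMeasure P → IsMarkovChainFrom P Z rho k →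
          ∫⁻ ω, ((tauTil Z h ω : ℕ∞) : ℝ≥0∞) ∂P <
            ENNReal.ofReal (C * (h : ℝ) ^ ((1 : ℝ) / 2 + ε)) := by
  intro ε hε
  obtain ⟨A, hA, hexp⟩ := exists_eight_mul_le_exp hε
  refine ⟨16 * A + 8, fun h k hh hk _ Ω _ P Z _ hZ => ?_⟩
  have hh' : (1 : ℝ) ≤ h := by exact_mod_cast hh
  have hsplit : (h : ℝ) ^ ((1 : ℝ) / 2 + ε) = √h * (h : ℝ) ^ ε := by
    rw [Real.rpow_add (by positivity), Real.sqrt_eq_rpow]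
  set r := (h : ℝ) ^ ((1 : ℝ) / 2 + ε) with hr
  have hr1 : 1 ≤ r := Real.one_le_rpow hh' (by positivity)
  have hsq : 0 < √(h : ℝ) := by positivity
  obtain ⟨S, hS1, hS2⟩ : ∃ S : ℕ, 4 * A * r ≤ S ∧ (S : ℝ) < 4 * A * r + 1 :=
    ⟨_, Nat.le_ceil _, Nat.ceil_lt_add_one (by positivity)⟩
  have hu2 : (1 / (2 * √(h : ℝ))) ^ 2 * h = 1 / 4 := by
    rw [div_pow, mul_pow, Real.sq_sqrt (by positivity)]
    field_simp
    norm_num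
  have hstep := lyapunov_step (S := S) hh (by positivity) hu2 (by
    refine (hexp h hh).trans (Real.exp_le_exp.mpr ?_)
    calc A * (h : ℝ) ^ ε = 1 / (2 * √(h : ℝ)) * (4 * A * r) / 2 := by
          rw [hsplit]; field_simp; norm_num
      _ ≤ _ := by gcongr)
  have hsum := sum_survival_le (h := h)
    (f := fun i => 2 * (((h / 2 + 2 * S - i : ℕ) : ℝ) + 1)) (fun i => by positivity)
    (fun i => by
      have := hstep i
      simp only [mul_left_comm _ (2 : ℝ), ← Finset.mul_sum]
      linarith)
  refine (lintegral_tauTil_le hZ fun N => hsum N k).trans_lt ?_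
  refine (ENNReal.ofReal_lt_ofReal_iff (by positivity)).mpr ?_
  have hB : ((h / 2 + 2 * S - k : ℕ) : ℝ) ≤ r / 2 + 2 * S := by
    rcases le_total (h / 2 + 2 * S) k with hc | hc
    · rw [Nat.sub_eq_zero_of_le hc]; push_cast; positivity
    · rw [Nat.cast_sub hc]
      have : ((h / 2 : ℕ) : ℝ) ≤ h / 2 := Nat.cast_div_le
      push_cast
      linarith
  nlinarith
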